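/- arXiv:1908.08882 — 2 statements merged into one kernel-verified Lean document; each statement's English description precedes it below -/
import Mathlib

section
/- Let 𝒢 = (G_1,…,G_k) be a sunflower graph with shared graph S = (V_S, E_S). Then 𝒢 admits a simultaneous proper interval representation if and only if there exist a linear order ζ of V_S and, for each i ∈ {1,…,k}, a straight enumeration σ_i of G_i that is compatible with ζ. -/
/-!
Common definitions: graphs on a vertex subset, (proper/unit) interval
representations, blocks, straight enumerations, sunflower graphs,
simultaneous enumerations, components, chains/bars, etc.
-/

universe u

/-- A finite simple graph on a subset `verts` of an ambient vertex type `V`. -/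
structure GraphOn (V : Type u) where
  verts : Set V
  Adj : V → V → Prop
  symm : ∀ {u v}, Adj u v → Adj v u
  loopless : ∀ v, ¬ Adj v v
  mem_of_adj : ∀ {u v}, Adj u v → u ∈ verts ∧ v ∈ verts

namespace GraphOn

variable {V : Type u}

/-- The closed real interval assigned to vertex `v` by the endpoint map `I`. -/
def ivl (I : V → ℝ × ℝ) (v : V) : Set ℝ := Set.Icc (I v).1 (I v).2

/-- `I` is an interval representation of `G`: each vertex gets a (nonempty) closed
interval and intervals of distinct vertices intersect iff the vertices are adjacent. -/
def IsRep (G : GraphOn V) (I : V → ℝ × ℝ) : Prop :=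
  (∀ v ∈ G.verts, (I v).1 ≤ (I v).2) ∧
    ∀ u ∈ G.verts, ∀ v ∈ G.verts, u ≠ v → ((ivl I u ∩ ivl I v).Nonempty ↔ G.Adj u v)

/-- A proper interval representation: no interval properly contains another. -/
def IsProperRep (G : GraphOn V) (I : V → ℝ × ℝ) : Prop :=
  G.IsRep I ∧ ∀ u ∈ G.verts, ∀ v ∈ G.verts, u ≠ v → ¬ ivl I v ⊂ ivl I u

/-- A unit interval representation: all intervals have length one. -/
def IsUnitRep (G : GraphOn V) (I : V → ℝ × ℝ) : Prop :=
  G.IsRep I ∧ ∀ v ∈ G.verts, (I v).2 = (I v).1 + 1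

/-- Two vertices are in the same block iff they have equal closed neighborhoods. -/
def SameBlock (G : GraphOn V) (u v : V) : Prop :=
  u ∈ G.verts ∧ v ∈ G.verts ∧ ∀ w, (G.Adj u w ∨ u = w) ↔ (G.Adj v w ∨ v = w)

/-- Block-level closed adjacency: adjacent or in the same block. -/
def CAdj (G : GraphOn V) (u v : V) : Prop := G.Adj u v ∨ G.SameBlock u v

/-- `u` and `v` lie in the same connected component of `G` (and in `G`). -/
def Reach (G : GraphOn V) (u v : V) : Prop :=
  u ∈ G.verts ∧ v ∈ G.verts ∧ Relation.ReflTransGen G.Adj u v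

/-- The subgraph of `G` induced on the vertices of `G` lying in `C`. -/
def restrict (G : GraphOn V) (C : Set V) : GraphOn V where
  verts := G.verts ∩ C
  Adj u v := G.Adj u v ∧ u ∈ C ∧ v ∈ C
  symm h := ⟨G.symm h.1, h.2.2, h.2.1⟩
  loopless v h := G.loopless v h.1
  mem_of_adj h := ⟨⟨(G.mem_of_adj h.1).1, h.2.1⟩, (G.mem_of_adj h.1).2, h.2.2⟩

end GraphOn

open GraphOn

variable {V : Type u}

/-- The union graph `G_1 ∪ … ∪ G_k`. -/
def unionGraph {k : ℕ} (G : Fin k → GraphOn V) : GraphOn V where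
  verts := ⋃ i, (G i).verts
  Adj u v := ∃ i, (G i).Adj u v
  symm h := h.elim fun i hi => ⟨i, (G i).symm hi⟩
  loopless v h := h.elim fun i hi => (G i).loopless v hi
  mem_of_adj h := h.elim fun i hi =>
    ⟨Set.mem_iUnion.2 ⟨i, ((G i).mem_of_adj hi).1⟩,
     Set.mem_iUnion.2 ⟨i, ((G i).mem_of_adj hi).2⟩⟩

/-- A straight enumeration of `G`, encoded at the vertex level: `le u v` means the
block of `u` comes at or before the block of `v`.  It is a total preorder on the
vertices whose equivalence classes are exactly the blocks, and such that every block
together with its adjacent blocks is consecutive. -/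
structure StraightEnum {V : Type u} (G : GraphOn V) where
  le : V → V → Prop
  refl : ∀ v ∈ G.verts, le v v
  trans : ∀ u ∈ G.verts, ∀ v ∈ G.verts, ∀ w ∈ G.verts, le u v → le v w → le u w
  total : ∀ u ∈ G.verts, ∀ v ∈ G.verts, le u v ∨ le v u
  eq_block : ∀ u ∈ G.verts, ∀ v ∈ G.verts, (le u v ∧ le v u ↔ G.SameBlock u v)
  straight : ∀ u ∈ G.verts, ∀ v ∈ G.verts, ∀ w ∈ G.verts,
    le u v → le v w → G.CAdj u w → G.CAdj u v ∧ G.CAdj v w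

/-- `B(u,G) <_σ B(v,G)`: the block of `u` comes strictly before the block of `v`. -/
def StraightEnum.lt {V : Type u} {G : GraphOn V} (σ : StraightEnum G) (u v : V) : Prop :=
  σ.le u v ∧ ¬ σ.le v u

/-- `le` is a linear order on the set `s`. -/
def IsLinOrdOn (s : Set V) (le : V → V → Prop) : Prop :=
  (∀ v ∈ s, le v v) ∧ (∀ u ∈ s, ∀ v ∈ s, ∀ w ∈ s, le u v → le v w → le u w) ∧
    (∀ u ∈ s, ∀ v ∈ s, le u v → le v u → u = v) ∧ (∀ u ∈ s, ∀ v ∈ s, le u v ∨ le v u)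

/-- `le` is a partial order on the set `s`. -/
def IsPartialOrderOn (s : Set V) (le : V → V → Prop) : Prop :=
  (∀ v ∈ s, le v v) ∧ (∀ u ∈ s, ∀ v ∈ s, ∀ w ∈ s, le u v → le v w → le u w) ∧
    (∀ u ∈ s, ∀ v ∈ s, le u v → le v u → u = v)

/-- `S` is an induced subgraph of `G`. -/
def IsInduced (S G : GraphOn V) : Prop :=
  S.verts ⊆ G.verts ∧ ∀ u ∈ S.verts, ∀ v ∈ S.verts, (S.Adj u v ↔ G.Adj u v)

/-- `(G_1,…,G_k)` is a sunflower graph with shared graph `S`: any two distinct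
graphs share exactly `S` (vertices and edges), and `S` is induced in each `G_i`. -/
def IsSunflower {k : ℕ} (G : Fin k → GraphOn V) (S : GraphOn V) : Prop :=
  (∀ i, IsInduced S (G i)) ∧
    ∀ i j, i ≠ j → (G i).verts ∩ (G j).verts = S.verts ∧
      ∀ u v, (G i).Adj u v → (G j).Adj u v → S.Adj u v

/-- `𝒢` admits a simultaneous interval representation. -/
def HasSimRep {k : ℕ} (G : Fin k → GraphOn V) : Prop :=
  ∃ I : V → ℝ × ℝ, ∀ i, (G i).IsRep I

/-- `𝒢` admits a simultaneous proper interval representation. -/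
def HasSimProperRep {k : ℕ} (G : Fin k → GraphOn V) : Prop :=
  ∃ I : V → ℝ × ℝ, ∀ i, (G i).IsProperRep I

/-- `𝒢` admits a simultaneous unit interval representation. -/
def HasSimUnitRep {k : ℕ} (G : Fin k → GraphOn V) : Prop :=
  ∃ I : V → ℝ × ℝ, ∀ i, (G i).IsUnitRep I

/-- The representation `I` of `G` corresponds to (realizes) the straight enumeration `σ`:
ordering the intervals by left endpoints and grouping blocks yields `σ`. -/
def Realizes (G : GraphOn V) (I : V → ℝ × ℝ) (σ : StraightEnum G) : Prop :=
  ∀ u ∈ G.verts, ∀ v ∈ G.verts, σ.lt u v → (I u).1 < (I v).1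

/-- Simultaneous enumeration: blocks containing shared vertices are never ordered
oppositely in two of the straight enumerations. -/
def IsSimEnum {k : ℕ} (G : Fin k → GraphOn V) (S : GraphOn V)
    (σ : ∀ i, StraightEnum (G i)) : Prop :=
  ∀ i j, ∀ u ∈ S.verts, ∀ v ∈ S.verts, (σ i).lt u v → (σ j).le u v

/-- A straight enumeration `σ` of `G` is compatible with a linear order `ζ` of the
shared vertex set `VS`: `u ≤_ζ v` implies `B(u,G) ≤_σ B(v,G)`. -/
def Compatible (G : GraphOn V) (σ : StraightEnum G) (VS : Set V) (ζ : V → V → Prop) : Prop :=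
  ∀ u ∈ VS, ∀ v ∈ VS, ζ u v → σ.le u v

/-- The component of `c` in `G` is loose: all its shared vertices lie in one block of `S`. -/
def LooseAt (G S : GraphOn V) (c : V) : Prop :=
  c ∈ G.verts ∧ ∀ u v, G.Reach c u → G.Reach c v → u ∈ S.verts → v ∈ S.verts → S.SameBlock u v

/-- The component of `c` in `G` is oriented at the block of `b` in `S`: it aligns two
vertices of that block (they lie in different blocks of the component). -/
def OrientedAt (G S : GraphOn V) (c b : V) : Prop :=
  c ∈ G.verts ∧ b ∈ S.verts ∧ ∃ u v, G.Reach c u ∧ G.Reach c v ∧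
    S.SameBlock b u ∧ S.SameBlock b v ∧ ¬ G.SameBlock u v

/-- The component of `c` in `G` is independent: it aligns no two shared vertices. -/
def IndependentAt (G S : GraphOn V) (c : V) : Prop :=
  c ∈ G.verts ∧ ∀ u v, G.Reach c u → G.Reach c v → u ∈ S.verts → v ∈ S.verts → G.SameBlock u v

/-- `le'` is obtained from `le` by reversing exactly the components marked by `flip`
(componentwise-constant), keeping the order of the components themselves. -/
def ObtainedByFlip (G : GraphOn V) (flip : V → Prop) (le le' : V → V → Prop) : Prop :=
  (∀ u v, G.Reach u v → (flip u ↔ flip v)) ∧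
    ∀ u ∈ G.verts, ∀ v ∈ G.verts,
      (G.Reach u v → ((flip u → (le' u v ↔ le v u)) ∧ (¬ flip u → (le' u v ↔ le u v)))) ∧
      (¬ G.Reach u v → (le' u v ↔ le u v))

/-- `le'` is obtained from `le` through reversal of loose components. -/
def ObtainedByLooseReversals (G S : GraphOn V) (le le' : V → V → Prop) : Prop :=
  ∃ flip : V → Prop, (∀ c ∈ G.verts, flip c → LooseAt G S c) ∧
    ObtainedByFlip G flip le le'

/-- A family of flips (one per graph) corresponding to reversals of independent
components and of reversible parts: only loose components are flipped, and all
components oriented at a common block of `S` are flipped consistently and, if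
flipped, are all loose. -/
def ValidFlips {k : ℕ} (G : Fin k → GraphOn V) (S : GraphOn V)
    (flip : Fin k → V → Prop) : Prop :=
  (∀ i, ∀ c ∈ (G i).verts, flip i c → LooseAt (G i) S c) ∧
    ∀ b ∈ S.verts, ∀ i j c c', OrientedAt (G i) S c b → OrientedAt (G j) S c' b →
      (flip i c ↔ flip j c') ∧ (flip i c → LooseAt (G j) S c')

/-- `le` is a fine enumeration of the graph with vertex set `verts` and adjacency
`Adj`: a linear order on `verts` in which every closed neighborhood is consecutive. -/
def FineEnumOn (verts : Set V) (Adj : V → V → Prop) (le : V → V → Prop) : Prop :=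
  IsLinOrdOn verts le ∧
    ∀ u ∈ verts, ∀ a ∈ verts, ∀ b ∈ verts, ∀ c ∈ verts,
      le a b → le b c → (Adj u a ∨ u = a) → (Adj u c ∨ u = c) → (Adj u b ∨ u = b)

/-- A `(u,v)`-chain of size `l` in `(G,σ)`: a `σ`-increasing sequence from `u` to `v`
forming a path in `G`. -/
def IsChainSeq (G : GraphOn V) (σ : StraightEnum G) (u v : V) (l : ℕ) : Prop :=
  ∃ c : ℕ → V, c 0 = u ∧ c (l - 1) = v ∧ (∀ t < l, c t ∈ G.verts) ∧
    (∀ s t, s < t → t < l → σ.lt (c s) (c t)) ∧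
    (∀ t, t + 1 < l → G.Adj (c t) (c (t + 1)))

/-- A `(u,v)`-bar of size `l` in `(G,σ)`: a `σ`-increasing sequence from `u` to `v`
forming an independent set in `G`. -/
def IsBarSeq (G : GraphOn V) (σ : StraightEnum G) (u v : V) (l : ℕ) : Prop :=
  ∃ b : ℕ → V, b 0 = u ∧ b (l - 1) = v ∧ (∀ t < l, b t ∈ G.verts) ∧
    (∀ s t, s < t → t < l → σ.lt (b s) (b t)) ∧
    (∀ s t, s < l → t < l → s ≠ t → ¬ G.Adj (b s) (b t))

/-- `𝒢` has a (chain-bar-)conflict for the simultaneous enumeration `σ`. -/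
def HasConflict {k : ℕ} (G : Fin k → GraphOn V) (S : GraphOn V)
    (σ : ∀ i, StraightEnum (G i)) : Prop :=
  ∃ u ∈ S.verts, ∃ v ∈ S.verts, u ≠ v ∧ ∃ i j l, 2 ≤ l ∧
    IsChainSeq (G i) (σ i) u v l ∧ ∃ m, l ≤ m ∧ IsBarSeq (G j) (σ j) u v m

/-- The union of the block orders of the single enumerations. -/
def alphaStar {k : ℕ} (G : Fin k → GraphOn V) (σ : ∀ i, StraightEnum (G i))
    (u v : V) : Prop :=
  ∃ i, u ∈ (G i).verts ∧ v ∈ (G i).verts ∧ (σ i).le u v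

/-- The partial order `α` on `V(𝒢)` induced by the simultaneous enumeration:
the transitive closure of the union of the single block orders. -/
def alphaOrd {k : ℕ} (G : Fin k → GraphOn V) (σ : ∀ i, StraightEnum (G i)) :
    V → V → Prop :=
  Relation.TransGen (alphaStar G σ)

/-- The `α`-ordered pairs that are edges of some `G_i`. -/
def ERel {k : ℕ} (G : Fin k → GraphOn V) (σ : ∀ i, StraightEnum (G i))
    (u v : V) : Prop :=
  alphaOrd G σ u v ∧ ∃ i, (G i).Adj u v

/-- The `α`-ordered pairs that are non-edges of some `G_i` (both endpoints in `G_i`). -/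
def FRel {k : ℕ} (G : Fin k → GraphOn V) (σ : ∀ i, StraightEnum (G i))
    (u v : V) : Prop :=
  alphaOrd G σ u v ∧ u ≠ v ∧ ∃ i, u ∈ (G i).verts ∧ v ∈ (G i).verts ∧ ¬ (G i).Adj u v

/-- A partial order `τ` is left-closed: `(v,w) ∈ E`, `(u,x) ∈ F` and `x ≤_τ w`
imply `u <_τ v`. -/
def LeftClosed {k : ℕ} (G : Fin k → GraphOn V) (σ : ∀ i, StraightEnum (G i))
    (τ : V → V → Prop) : Prop :=
  ∀ v w u x, ERel G σ v w → FRel G σ u x → τ x w → τ u v ∧ u ≠ v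

/-- A relaxed `(u,v)`-chain of size `l`: an `α`-increasing sequence from `u` to `v`
forming a path in the union graph `G* = G_1 ∪ … ∪ G_k`. -/
def IsRelaxedChainSeq {k : ℕ} (G : Fin k → GraphOn V) (σ : ∀ i, StraightEnum (G i))
    (u v : V) (l : ℕ) : Prop :=
  ∃ c : ℕ → V, c 0 = u ∧ c (l - 1) = v ∧ (∀ t < l, c t ∈ ⋃ i, (G i).verts) ∧
    (∀ s t, s < t → t < l → alphaOrd G σ (c s) (c t) ∧ c s ≠ c t) ∧
    (∀ t, t + 1 < l → ∃ i, (G i).Adj (c t) (c (t + 1)))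

/-- `𝒢` has a relaxed conflict for the simultaneous enumeration `σ`. -/
def HasRelaxedConflict {k : ℕ} (G : Fin k → GraphOn V) (S : GraphOn V)
    (σ : ∀ i, StraightEnum (G i)) : Prop :=
  ∃ u ∈ S.verts, ∃ v ∈ S.verts, u ≠ v ∧ ∃ j l, 2 ≤ l ∧
    IsRelaxedChainSeq G σ u v l ∧ ∃ m, l ≤ m ∧ IsBarSeq (G j) (σ j) u v m

section CutRank

variable {α : Type*}

/-- A rank for the preorder `P` on `X` that counts the elements of `T` below `x` with a large
weight, and the elements of `X` strictly above all of these. On `T` it depends only on the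
restriction of `P` to `T`. -/
noncomputable def cutRank (X T : Set α) (P : α → α → Prop) (x : α) : ℕ :=
  {t | t ∈ T ∧ P t x}.ncard * (Nat.card α + 1) +
    {y | y ∈ X ∧ P y x ∧ ∀ t ∈ T, P t x → ¬ P y t}.ncard

theorem cutRank_of_mem (X : Set α) {T : Set α} {P : α → α → Prop} {x : α} (hx : x ∈ T)
    (hrefl : P x x) :
    cutRank X T P x = {t | t ∈ T ∧ P t x}.ncard * (Nat.card α + 1) := by
  have h : {y | y ∈ X ∧ P y x ∧ ∀ t ∈ T, P t x → ¬ P y t} = ∅ := by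
    ext y
    simp only [Set.mem_ofPred_eq, Set.mem_empty_iff_false, iff_false]
    rintro ⟨-, h1, h2⟩
    exact h2 x hx hrefl h1
  rw [cutRank, h, Set.ncard_empty, Nat.add_zero]

variable [Finite α]

theorem cutRank_lt_of_ncard_lt (X : Set α) {T : Set α} {P : α → α → Prop} {x y : α}
    (h : {t | t ∈ T ∧ P t x}.ncard < {t | t ∈ T ∧ P t y}.ncard) :
    cutRank X T P x < cutRank X T P y := by
  have h1 : {z | z ∈ X ∧ P z x ∧ ∀ t ∈ T, P t x → ¬ P z t}.ncard ≤ Nat.card α := by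
    rw [← Set.ncard_univ]
    exact Set.ncard_le_ncard (Set.subset_univ _)
  have h2 := Nat.mul_le_mul_right (Nat.card α + 1) (Nat.succ_le_of_lt h)
  rw [Nat.succ_mul] at h2
  unfold cutRank
  omega

theorem cutRank_le_cutRank_iff {X T : Set α} {P : α → α → Prop} (hT : T ⊆ X)
    (htrans : ∀ x ∈ X, ∀ y ∈ X, ∀ z ∈ X, P x y → P y z → P x z)
    (htotal : ∀ x ∈ X, ∀ y ∈ X, P x y ∨ P y x) {x y : α} (hx : x ∈ X) (hy : y ∈ X) :
    cutRank X T P x ≤ cutRank X T P y ↔ P x y := by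
  have hsub : ∀ {a b : α}, a ∈ X → b ∈ X → P a b →
      {t | t ∈ T ∧ P t a} ⊆ {t | t ∈ T ∧ P t b} := fun ha hb hab t ht =>
    ⟨ht.1, htrans _ (hT ht.1) _ ha _ hb ht.2 hab⟩
  have hback : ∀ {a b : α}, a ∈ X → b ∈ X → P a b →
      ¬ {t | t ∈ T ∧ P t a}.ncard < {t | t ∈ T ∧ P t b}.ncard →
      {t | t ∈ T ∧ P t a} = {t | t ∈ T ∧ P t b} := fun ha hb hab hn =>
    Set.eq_of_subset_of_ncard_le (hsub ha hb hab) (not_lt.1 hn)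
  constructor
  · contrapose!
    intro hxy
    have hyx : P y x := (htotal x hx y hy).resolve_left hxy
    by_cases hc : {t | t ∈ T ∧ P t y}.ncard < {t | t ∈ T ∧ P t x}.ncard
    · exact cutRank_lt_of_ncard_lt X hc
    have he := hback hy hx hyx hc
    have hm : ∀ t ∈ T, P t x → P t y := fun t ht htx =>
      (he.symm.subset (show t ∈ {t | t ∈ T ∧ P t x} from ⟨ht, htx⟩)).2
    unfold cutRank
    rw [he]
    refine Nat.add_lt_add_left (Set.ncard_lt_ncard ⟨?_, fun hss => ?_⟩) _
    · rintro z ⟨hz, hzy, hzt⟩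
      exact ⟨hz, htrans z hz y hy x hx hzy hyx, fun t ht htx => hzt t ht (hm t ht htx)⟩
    · have hxx : P x x := (htotal x hx x hx).elim id id
      exact hxy (hss ⟨hx, hxx, fun t ht htx hxt =>
        hxy (htrans x hx t (hT ht) y hy hxt (hm t ht htx))⟩).2.1
  · intro hxy
    by_cases hc : {t | t ∈ T ∧ P t x}.ncard < {t | t ∈ T ∧ P t y}.ncard
    · exact (cutRank_lt_of_ncard_lt X hc).le
    have he := hback hx hy hxy hc
    unfold cutRank
    rw [he]
    refine Nat.add_le_add_left (Set.ncard_le_ncard ?_) _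
    rintro z ⟨hz, hzx, hzt⟩
    refine ⟨hz, htrans z hz x hx y hy hzx hxy, fun t ht hty => hzt t ht ?_⟩
    exact (he.symm.subset (show t ∈ {t | t ∈ T ∧ P t y} from ⟨ht, hty⟩)).2

end CutRank

/-- The order of the interval endpoints (`false` left, `true` right) of a proper interval
representation with vertex order `le` and adjacency `A`. -/
def endpointLE (le A : V → V → Prop) : V × Bool → V × Bool → Prop
  | (u, false), (v, false) => le u v
  | (u, true), (v, true) => le u v
  | (u, false), (v, true) => A u v ∨ le u v
  | (u, true), (v, false) => ¬ (A v u ∨ le v u)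

theorem endpointLE_total {X : Set V} {le : V → V → Prop} (A : V → V → Prop)
    (htotal : ∀ u ∈ X, ∀ v ∈ X, le u v ∨ le v u) :
    ∀ x : V × Bool, x.1 ∈ X → ∀ y : V × Bool, y.1 ∈ X →
      endpointLE le A x y ∨ endpointLE le A y x := by
  rintro ⟨u, _ | _⟩ hu ⟨v, _ | _⟩ hv <;> simp only [endpointLE]
  · exact htotal u hu v hv
  · exact em _
  · exact (em _).symm
  · exact htotal u hu v hv

theorem endpointLE_trans {X : Set V} {le A : V → V → Prop}
    (htotal : ∀ u ∈ X, ∀ v ∈ X, le u v ∨ le v u)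
    (htrans : ∀ u ∈ X, ∀ v ∈ X, ∀ w ∈ X, le u v → le v w → le u w)
    (hsymm : ∀ u v, A u v → A v u)
    (hstraight : ∀ u ∈ X, ∀ v ∈ X, ∀ w ∈ X, le u v → le v w → A u w → A u v ∧ A v w) :
    ∀ x : V × Bool, x.1 ∈ X → ∀ y : V × Bool, y.1 ∈ X → ∀ z : V × Bool, z.1 ∈ X →
      endpointLE le A x y → endpointLE le A y z → endpointLE le A x z := by
  rintro ⟨u, _ | _⟩ hu ⟨v, _ | _⟩ hv ⟨w, _ | _⟩ hw <;> simp only [endpointLE] <;>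
    simp only at hu hv hw <;> grind

namespace GraphOn

theorem SameBlock.adj_or_eq {G : GraphOn V} {u v : V} (h : G.SameBlock u v) :
    G.Adj u v ∨ u = v :=
  (h.2.2 v).2 (Or.inr rfl)

theorem SameBlock.symm {G : GraphOn V} {u v : V} (h : G.SameBlock u v) : G.SameBlock v u :=
  ⟨h.2.1, h.1, fun w => (h.2.2 w).symm⟩

theorem SameBlock.refl {G : GraphOn V} {v : V} (h : v ∈ G.verts) : G.SameBlock v v :=
  ⟨h, h, fun _ => Iff.rfl⟩

theorem CAdj.symm {G : GraphOn V} {u v : V} (h : G.CAdj u v) : G.CAdj v u :=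
  h.imp G.symm SameBlock.symm

theorem cAdj_iff {G : GraphOn V} {u v : V} (hv : v ∈ G.verts) :
    G.CAdj u v ↔ G.Adj u v ∨ u = v := by
  refine ⟨fun h => h.elim Or.inl SameBlock.adj_or_eq, fun h => h.imp_right ?_⟩
  rintro rfl
  exact SameBlock.refl hv

theorem ivl_inter_ivl_nonempty_iff {I : V → ℝ × ℝ} {u v : V} (hu : (I u).1 ≤ (I u).2)
    (hv : (I v).1 ≤ (I v).2) :
    (ivl I u ∩ ivl I v).Nonempty ↔ (I u).1 ≤ (I v).2 ∧ (I v).1 ≤ (I u).2 := by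
  unfold ivl
  rw [Set.Icc_inter_Icc, Set.nonempty_Icc]
  simp only [sup_le_iff, le_inf_iff]
  tauto

section ProperRep

variable {G : GraphOn V} {I : V → ℝ × ℝ}

theorem IsProperRep.cAdj_iff (h : G.IsProperRep I) {u v : V} (hu : u ∈ G.verts)
    (hv : v ∈ G.verts) : G.CAdj u v ↔ (I u).1 ≤ (I v).2 ∧ (I v).1 ≤ (I u).2 := by
  rw [GraphOn.cAdj_iff hv, ← ivl_inter_ivl_nonempty_iff (h.1.1 u hu) (h.1.1 v hv)]
  by_cases huv : u = v
  · subst huv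
    simpa [ivl] using h.1.1 u hu
  · rw [h.1.2 u hu v hv huv]
    simp [huv]

theorem IsProperRep.right_le_right (h : G.IsProperRep I) {u v : V} (hu : u ∈ G.verts)
    (hv : v ∈ G.verts) (huv : (I u).1 ≤ (I v).1) : (I u).2 ≤ (I v).2 := by
  by_contra! hlt
  refine h.2 u hu v hv (fun he => ?_) ⟨Set.Icc_subset_Icc huv hlt.le, fun hs => ?_⟩
  · subst he
    exact lt_irrefl _ hlt
  · exact not_le.2 hlt (hs (Set.right_mem_Icc.2 (h.1.1 u hu))).2

theorem sameBlock_iff {u v : V} (hu : u ∈ G.verts) (hv : v ∈ G.verts) :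
    G.SameBlock u v ↔ ∀ w ∈ G.verts, (G.CAdj u w ↔ G.CAdj v w) := by
  constructor
  · intro h w hw
    rw [GraphOn.cAdj_iff hw, GraphOn.cAdj_iff hw]
    exact h.2.2 w
  · intro h
    refine ⟨hu, hv, fun w => ?_⟩
    by_cases hw : w ∈ G.verts
    · rw [← GraphOn.cAdj_iff hw, ← GraphOn.cAdj_iff hw]
      exact h w hw
    · have h1 : ∀ x ∈ G.verts, ¬ (G.Adj x w ∨ x = w) := by
        rintro x hx (ha | rfl)
        · exact hw (G.mem_of_adj ha).2
        · exact hw hx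
      simp only [h1 u hu, h1 v hv]

/-- The blocks are convex with respect to the order of the left endpoints. -/
theorem IsProperRep.sameBlock_of_between (h : G.IsProperRep I) {u v w : V} (hu : u ∈ G.verts)
    (hv : v ∈ G.verts) (hw : w ∈ G.verts) (huv : (I u).1 ≤ (I v).1) (hvw : (I v).1 ≤ (I w).1)
    (huw : G.SameBlock u w) : G.SameBlock u v := by
  have h1 := h.right_le_right hu hv huv
  have h2 := h.right_le_right hv hw hvw
  rw [sameBlock_iff hu hw] at huw
  rw [sameBlock_iff hu hv]
  intro x hx
  have h3 := huw x hx
  rw [h.cAdj_iff hu hx, h.cAdj_iff hw hx] at h3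
  rw [h.cAdj_iff hu hx, h.cAdj_iff hv hx]
  constructor
  · intro h4
    exact ⟨hvw.trans (h3.1 h4).1, h4.2.trans h1⟩
  · intro h4
    by_cases hux : (I x).1 ≤ (I u).2
    · exact ⟨huv.trans h4.1, hux⟩
    · have hxu : (I u).1 ≤ (I x).2 := huv.trans h4.1
      have hwx : (I w).1 ≤ (I x).2 := by
        have h5 := huw u hu
        rw [h.cAdj_iff hu hu, h.cAdj_iff hw hu] at h5
        have h6 := (h5.1 ⟨h.1.1 u hu, h.1.1 u hu⟩).1
        have := h.1.1 x hx
        push Not at hux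
        linarith
      exact h3.2 ⟨hwx, h4.2.trans h2⟩

/-- The straight enumeration given by the order of the left endpoints. -/
def IsProperRep.straightEnum (h : G.IsProperRep I) : StraightEnum G where
  le u v := (I u).1 ≤ (I v).1 ∨ G.SameBlock u v
  refl v _ := Or.inl le_rfl
  trans := by
    have key : ∀ {a b : V}, a ∈ G.verts → b ∈ G.verts → G.SameBlock a b →
        ∀ w, w ∈ G.verts → (G.SameBlock a w ↔ G.SameBlock b w) := by
      intro a b ha hb hab w hw
      exact ⟨fun h' => ⟨hb, hw, fun x => (hab.2.2 x).symm.trans (h'.2.2 x)⟩,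
        fun h' => ⟨ha, hw, fun x => (hab.2.2 x).trans (h'.2.2 x)⟩⟩
    rintro u hu v hv w hw (huv | huv) (hvw | hvw)
    · exact Or.inl (huv.trans hvw)
    · rcases le_total (I u).1 (I w).1 with h1 | h1
      · exact Or.inl h1
      · exact Or.inr (h.sameBlock_of_between hw hu hv h1 huv hvw.symm).symm
    · rcases le_total (I u).1 (I w).1 with h1 | h1
      · exact Or.inl h1
      · refine Or.inr ?_
        have := h.sameBlock_of_between hv hw hu hvw h1 huv.symm
        exact (key hu hv huv w hw).2 this
    · exact Or.inr ((key hu hv huv w hw).2 hvw)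
  total u _ v _ := (le_total (I u).1 (I v).1).imp Or.inl Or.inl
  eq_block := by
    intro u hu v hv
    refine ⟨?_, fun h' => ⟨Or.inr h', Or.inr h'.symm⟩⟩
    rintro ⟨huv | huv, hvu | hvu⟩
    · exact h.sameBlock_of_between hu hv hu huv hvu (SameBlock.refl hu)
    · exact hvu.symm
    · exact huv
    · exact huv
  straight := by
    rintro u hu v hv w hw (huv | huv) hvw huw
    · rcases hvw with hvw | hvw
      · rw [h.cAdj_iff hu hw] at huw
        rw [h.cAdj_iff hu hv, h.cAdj_iff hv hw]
        have h1 := h.right_le_right hu hv huv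
        have h2 := h.right_le_right hv hw hvw
        have h3 := h.1.1 v hv
        exact ⟨⟨huv.trans h3, hvw.trans huw.2⟩, h3.trans h2, huw.2.trans h1⟩
      · exact ⟨(((sameBlock_iff hv hw).1 hvw u hu).2 huw.symm).symm, Or.inr hvw⟩
    · exact ⟨Or.inr huv, ((sameBlock_iff hu hv).1 huv w hw).1 huw⟩

end ProperRep

end GraphOn

section Refine

variable {G : GraphOn V}

/-- The refinement of `σ` placing, within each block, first the vertices outside `T`, all at
the same position, and then the vertices of `T` in the order `ζ`. -/
def StraightEnum.refineLE (σ : StraightEnum G) (T : Set V) (ζ : V → V → Prop) (u v : V) : Prop :=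
  σ.le u v ∧ (σ.le v u → u ∈ T → v ∈ T ∧ ζ u v)

/-- The order of the interval endpoints of `G` given by `σ`, refined by `ζ`. -/
def StraightEnum.endpointLE (σ : StraightEnum G) (T : Set V) (ζ : V → V → Prop) :
    V × Bool → V × Bool → Prop :=
  _root_.endpointLE (σ.refineLE T ζ) G.CAdj

/-- The position of an interval endpoint of `G`; it depends on `T` and `ζ` only, for the
endpoints of the intervals of `T`. -/
noncomputable def StraightEnum.endpointRank (σ : StraightEnum G) (T : Set V) (ζ : V → V → Prop) :
    V × Bool → ℕ :=
  cutRank {x | x.1 ∈ G.verts} {x | x.1 ∈ T} (σ.endpointLE T ζ)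

variable {T : Set V} {ζ : V → V → Prop} (σ : StraightEnum G)

theorem StraightEnum.refineLE_total (hζ : IsLinOrdOn T ζ) :
    ∀ u ∈ G.verts, ∀ v ∈ G.verts, σ.refineLE T ζ u v ∨ σ.refineLE T ζ v u := by
  intro u hu v hv
  have h1 := σ.total u hu v hv
  have h2 := hζ.2.2.2 u
  unfold StraightEnum.refineLE
  grind

theorem StraightEnum.refineLE_trans (hζ : IsLinOrdOn T ζ) :
    ∀ u ∈ G.verts, ∀ v ∈ G.verts, ∀ w ∈ G.verts,
      σ.refineLE T ζ u v → σ.refineLE T ζ v w → σ.refineLE T ζ u w := by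
  rintro u hu v hv w hw ⟨huv, huv'⟩ ⟨hvw, hvw'⟩
  refine ⟨σ.trans u hu v hv w hw huv hvw, fun hwu huT => ?_⟩
  obtain ⟨hvT, h1⟩ := huv' (σ.trans v hv w hw u hu hvw hwu) huT
  obtain ⟨hwT, h2⟩ := hvw' (σ.trans w hw u hu v hv hwu huv) hvT
  exact ⟨hwT, hζ.2.1 u huT v hvT w hwT h1 h2⟩

theorem StraightEnum.refineLE_iff (hζ : IsLinOrdOn T ζ) (hc : Compatible G σ T ζ)
    {u v : V} (hu : u ∈ T) (hv : v ∈ T) : σ.refineLE T ζ u v ↔ ζ u v := by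
  refine ⟨fun h => ?_, fun h => ⟨hc u hu v hv h, fun _ _ => ⟨hv, h⟩⟩⟩
  rcases hζ.2.2.2 u hu v hv with h1 | h1
  · exact h1
  · exact (h.2 (hc v hv u hu h1) hu).2

theorem StraightEnum.endpointRank_le_iff [Finite V] (hT : T ⊆ G.verts) (hζ : IsLinOrdOn T ζ)
    {x y : V × Bool} (hx : x.1 ∈ G.verts) (hy : y.1 ∈ G.verts) :
    σ.endpointRank T ζ x ≤ σ.endpointRank T ζ y ↔ σ.endpointLE T ζ x y :=
  cutRank_le_cutRank_iff (X := {x : V × Bool | x.1 ∈ G.verts}) (fun _ h => hT h)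
    (endpointLE_trans (σ.refineLE_total hζ) (σ.refineLE_trans hζ) (fun _ _ => CAdj.symm)
      fun u hu v hv w hw huv hvw => σ.straight u hu v hv w hw huv.1 hvw.1)
    (endpointLE_total _ (σ.refineLE_total hζ)) hx hy

theorem StraightEnum.endpointLE_iff_of_isInduced {S : GraphOn V} (hS : IsInduced S G)
    (hζ : IsLinOrdOn S.verts ζ) (hc : Compatible G σ S.verts ζ) {x y : V × Bool}
    (hx : x.1 ∈ S.verts) (hy : y.1 ∈ S.verts) :
    σ.endpointLE S.verts ζ x y ↔ _root_.endpointLE ζ S.CAdj x y := by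
  have hA : ∀ u ∈ S.verts, ∀ v ∈ S.verts, (G.CAdj u v ↔ S.CAdj u v) := fun u hu v hv => by
    rw [GraphOn.cAdj_iff hv, GraphOn.cAdj_iff (hS.1 hv), hS.2 u hu v hv]
  obtain ⟨u, _ | _⟩ := x <;> obtain ⟨v, _ | _⟩ := y <;>
    simp only [StraightEnum.endpointLE, _root_.endpointLE, hA u hx v hy, hA v hy u hx,
      σ.refineLE_iff hζ hc hx hy, σ.refineLE_iff hζ hc hy hx]

theorem StraightEnum.endpointRank_of_mem {S : GraphOn V} (hS : IsInduced S G)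
    (hζ : IsLinOrdOn S.verts ζ) (hc : Compatible G σ S.verts ζ) {x : V × Bool}
    (hx : x.1 ∈ S.verts) :
    σ.endpointRank S.verts ζ x =
      {t : V × Bool | t.1 ∈ S.verts ∧ _root_.endpointLE ζ S.CAdj t x}.ncard *
        (Nat.card (V × Bool) + 1) := by
  have hrefl : σ.endpointLE S.verts ζ x x :=
    (endpointLE_total G.CAdj (σ.refineLE_total hζ) x (hS.1 hx) x (hS.1 hx)).elim id id
  have hset : {t : V × Bool | t ∈ {x : V × Bool | x.1 ∈ S.verts} ∧ σ.endpointLE S.verts ζ t x} =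
      {t | t.1 ∈ S.verts ∧ _root_.endpointLE ζ S.CAdj t x} := by
    ext t
    exact and_congr_right fun ht => σ.endpointLE_iff_of_isInduced hS hζ hc ht hx
  rw [StraightEnum.endpointRank,
    cutRank_of_mem _ (show x ∈ {x : V × Bool | x.1 ∈ S.verts} from hx) hrefl, hset]

theorem StraightEnum.isProperRep_of_eq_endpointRank [Finite V] (hT : T ⊆ G.verts)
    (hζ : IsLinOrdOn T ζ) {I : V → ℝ × ℝ}
    (hI : ∀ v ∈ G.verts,
      I v = ((σ.endpointRank T ζ (v, false) : ℝ), (σ.endpointRank T ζ (v, true) : ℝ))) :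
    G.IsProperRep I := by
  have hLR : ∀ u ∈ G.verts, ∀ v ∈ G.verts,
      ((I u).1 ≤ (I v).2 ↔ G.CAdj u v ∨ σ.refineLE T ζ u v) := fun u hu v hv => by
    rw [hI u hu, hI v hv]
    exact Nat.cast_le.trans
      (σ.endpointRank_le_iff hT hζ (x := (u, false)) (y := (v, true)) hu hv)
  have hLL : ∀ u ∈ G.verts, ∀ v ∈ G.verts,
      ((I u).1 ≤ (I v).1 ↔ σ.refineLE T ζ u v) := fun u hu v hv => by
    rw [hI u hu, hI v hv]
    exact Nat.cast_le.trans
      (σ.endpointRank_le_iff hT hζ (x := (u, false)) (y := (v, false)) hu hv)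
  have hRR : ∀ u ∈ G.verts, ∀ v ∈ G.verts,
      ((I u).2 ≤ (I v).2 ↔ σ.refineLE T ζ u v) := fun u hu v hv => by
    rw [hI u hu, hI v hv]
    exact Nat.cast_le.trans
      (σ.endpointRank_le_iff hT hζ (x := (u, true)) (y := (v, true)) hu hv)
  have hne : ∀ v ∈ G.verts, (I v).1 ≤ (I v).2 := fun v hv =>
    (hLR v hv v hv).2 (Or.inl (Or.inr (SameBlock.refl hv)))
  refine ⟨⟨hne, fun u hu v hv huv => ?_⟩, fun u hu v hv _ hss => ?_⟩
  · rw [ivl_inter_ivl_nonempty_iff (hne u hu) (hne v hv), hLR u hu v hv, hLR v hv u hu]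
    have hadj : G.CAdj u v ↔ G.Adj u v := by
      rw [GraphOn.cAdj_iff hv]
      simp [huv]
    rw [← hadj]
    refine ⟨?_, fun h => ⟨Or.inl h, Or.inl h.symm⟩⟩
    rintro ⟨h1 | h1, h2 | h2⟩
    · exact h1
    · exact h1
    · exact h2.symm
    · exact Or.inr ((σ.eq_block u hu v hv).1 ⟨h1.1, h2.1⟩)
  · obtain ⟨h1, h2⟩ := (Set.Icc_subset_Icc_iff (hne v hv)).1 hss.1
    have huv := (hLL u hu v hv).1 h1
    have hvu := (hRR v hv u hu).1 h2
    exact hss.2 (Set.Icc_subset_Icc ((hLL v hv u hu).2 hvu) ((hRR u hu v hv).2 huv))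

end Refine

/-- Any set of vertices can be sorted by a real-valued function, with ties broken. -/
theorem exists_isLinOrdOn_le [Finite V] (s : Set V) (f : V → ℝ) :
    ∃ ζ : V → V → Prop, IsLinOrdOn s ζ ∧ ∀ u v, ζ u v → f u ≤ f v := by
  obtain ⟨n, ⟨e⟩⟩ := Finite.exists_equiv_fin V
  refine ⟨fun u v => toLex (f u, e u) ≤ toLex (f v, e v),
    ⟨fun _ _ => le_rfl, fun _ _ _ _ _ _ => le_trans, fun u _ v _ h1 h2 => ?_,
      fun _ _ _ _ => le_total _ _⟩, fun u v h => ?_⟩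
  · have := le_antisymm h1 h2
    simpa using (Prod.ext_iff.1 (toLex.injective this)).2
  · rcases Prod.Lex.toLex_le_toLex.1 h with h1 | h1
    · exact h1.le
    · exact h1.1.le

/-- A sunflower graph admits a simultaneous proper interval
representation iff there are a linear order `ζ` of the shared vertices and straight
enumerations of the `G_i` compatible with `ζ`. -/
theorem hasSimProperRep_iff_compatible_enums {V : Type u} [Fintype V] {k : ℕ}
    (G : Fin k → GraphOn V) (S : GraphOn V) (hsun : IsSunflower G S) :
    HasSimProperRep G ↔
      ∃ ζ : V → V → Prop, IsLinOrdOn S.verts ζ ∧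
        ∃ σ : ∀ i, StraightEnum (G i), ∀ i, Compatible (G i) (σ i) S.verts ζ := by
  constructor
  · rintro ⟨I, hI⟩
    obtain ⟨ζ, hζ, hle⟩ := exists_isLinOrdOn_le S.verts fun v => (I v).1
    exact ⟨ζ, hζ, fun i => (hI i).straightEnum, fun i u _ v _ h => Or.inl (hle u v h)⟩
  · rintro ⟨ζ, hζ, σ, hσ⟩
    classical
    let J : Fin k → V → ℝ × ℝ := fun i v =>
      (((σ i).endpointRank S.verts ζ (v, false) : ℝ), ((σ i).endpointRank S.verts ζ (v, true) : ℝ))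
    have hJ : ∀ i j, ∀ v, v ∈ (G i).verts → v ∈ (G j).verts → J i v = J j v := by
      intro i j v hi hj
      by_cases hij : i = j
      · rw [hij]
      have hv : v ∈ S.verts := (hsun.2 i j hij).1.subset ⟨hi, hj⟩
      have hb : ∀ b, (σ i).endpointRank S.verts ζ (v, b) = (σ j).endpointRank S.verts ζ (v, b) :=
        fun b => ((σ i).endpointRank_of_mem (hsun.1 i) hζ (hσ i) (x := (v, b)) hv).trans
          ((σ j).endpointRank_of_mem (hsun.1 j) hζ (hσ j) (x := (v, b)) hv).symm
      simp only [J, hb]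
    refine ⟨fun v => if h : ∃ i, v ∈ (G i).verts then J h.choose v else 0, fun i =>
      (σ i).isProperRep_of_eq_endpointRank (hsun.1 i).1 hζ fun v hv => ?_⟩
    have h : ∃ i, v ∈ (G i).verts := ⟨i, hv⟩
    rw [dif_pos h]
    exact hJ _ i v h.choose_spec hv
end

section
/- Let 𝒢 = (G_1,…,G_k) be a sunflower graph. There exists a simultaneous proper interval representation ℛ = (R_1,…,R_k) of 𝒢 if and only if there exists a simultaneous enumeration (σ_1,…,σ_k) of 𝒢. Moreover, if a simultaneous enumeration (σ_1,…,σ_k) exists, then there exists a simultaneous proper interval representation ℛ such that for each i the straight enumeration extracted from R_i (ordering intervals by left endpoints and grouping blocks) equals σ_i. -/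
/-!
Common definitions: graphs on a vertex subset, (proper/unit) interval
representations, blocks, straight enumerations, sunflower graphs,
simultaneous enumerations, components, chains/bars, etc.
-/

universe u

open GraphOn

variable {V : Type u}

/-- A finite total preorder is induced by a map to the natural numbers. -/
theorem exists_nat_key {α : Type*} [Finite α] (T : Set α) (r : α → α → Prop)
    (htrans : ∀ u ∈ T, ∀ v ∈ T, ∀ w ∈ T, r u v → r v w → r u w)
    (htotal : ∀ u ∈ T, ∀ v ∈ T, r u v ∨ r v u) :
    ∃ c : α → ℕ, ∀ u ∈ T, ∀ v ∈ T, (c u ≤ c v ↔ r u v) := by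
  refine ⟨fun u => {w ∈ T | ¬ r u w}.ncard, fun u hu v hv => ⟨fun h => ?_, fun h => ?_⟩⟩
  · by_contra hn
    have hvu : r v u := (htotal u hu v hv).resolve_left hn
    refine absurd h (not_le.2 (Set.ncard_lt_ncard ?_ (Set.toFinite _)))
    refine (Set.ssubset_iff_of_subset ?_).2 ⟨v, ⟨hv, hn⟩, fun h' => h'.2 ?_⟩
    · exact fun w hw => ⟨hw.1, fun h' => hw.2 (htrans v hv u hu w hw.1 hvu h')⟩
    · exact (htotal v hv v hv).elim id id
  · exact Set.ncard_le_ncard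
      (fun w hw => ⟨hw.1, fun h' => hw.2 (htrans u hu v hv w hw.1 h h')⟩) (Set.toFinite _)

/-- A strictly increasing map whose values at the keys `c s`, `s ∈ T`, depend only on the
order that `c` induces on `T`. -/
noncomputable def levelMap {α : Type*} (T : Set α) (c : α → ℕ) (x : ℕ) : ℝ :=
  open Classical in
  ({s ∈ T | c s ≤ x}.ncard : ℝ) + ({s ∈ T | c s < x}.ncard : ℝ) +
    if ∃ s ∈ T, c s = x then 0 else (x : ℝ) / (x + 1)

theorem levelMap_strictMono {α : Type*} [Finite α] (T : Set α) (c : α → ℕ) :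
    StrictMono (levelMap T c) := by
  intro x y hxy
  have hfrac : ∀ n : ℕ, 0 ≤ (n : ℝ) / (n + 1) ∧ (n : ℝ) / (n + 1) < 1 := fun n =>
    ⟨by positivity, (div_lt_one (by positivity)).2 (by linarith)⟩
  have hle : {s ∈ T | c s ≤ x} ⊆ {s ∈ T | c s ≤ y} := fun s hs => ⟨hs.1, hs.2.trans hxy.le⟩
  have hlt : {s ∈ T | c s < x} ⊆ {s ∈ T | c s < y} := fun s hs => ⟨hs.1, hs.2.trans hxy⟩
  have h1 : ({s ∈ T | c s ≤ x}.ncard : ℝ) ≤ {s ∈ T | c s ≤ y}.ncard := by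
    exact_mod_cast Set.ncard_le_ncard hle (Set.toFinite _)
  have h2 : ({s ∈ T | c s < x}.ncard : ℝ) ≤ {s ∈ T | c s < y}.ncard := by
    exact_mod_cast Set.ncard_le_ncard hlt (Set.toFinite _)
  have hx := hfrac x
  have hy := hfrac y
  unfold levelMap
  by_cases ey : ∃ s ∈ T, c s = y
  · obtain ⟨s, hs, hsy⟩ := ey
    have h3 : ({s ∈ T | c s ≤ x}.ncard : ℝ) + 1 ≤ {s ∈ T | c s ≤ y}.ncard := by
      exact_mod_cast Set.ncard_lt_ncard ((Set.ssubset_iff_of_subset hle).2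
        ⟨s, ⟨hs, hsy.le⟩, fun h => by have := h.2; omega⟩) (Set.toFinite _)
    rw [if_pos (⟨s, hs, hsy⟩ : ∃ s ∈ T, c s = y)]
    split_ifs <;> linarith
  · by_cases ex : ∃ s ∈ T, c s = x
    · obtain ⟨s, hs, hsx⟩ := ex
      have h3 : ({s ∈ T | c s < x}.ncard : ℝ) + 1 ≤ {s ∈ T | c s < y}.ncard := by
        exact_mod_cast Set.ncard_lt_ncard ((Set.ssubset_iff_of_subset hlt).2
          ⟨s, ⟨hs, by omega⟩, fun h => by have := h.2; omega⟩) (Set.toFinite _)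
      rw [if_pos (⟨s, hs, hsx⟩ : ∃ s ∈ T, c s = x), if_neg ey]
      linarith
    · rw [if_neg ex, if_neg ey]
      have h3 : (x : ℝ) / (x + 1) < y / (y + 1) := by
        rw [div_lt_div_iff₀ (by positivity) (by positivity)]
        have : (x : ℝ) < y := by exact_mod_cast hxy
        linarith
      linarith

theorem levelMap_congr {α : Type*} {T : Set α} {c d : α → ℕ}
    (h : ∀ p ∈ T, ∀ q ∈ T, (c p ≤ c q ↔ d p ≤ d q)) {p : α} (hp : p ∈ T) :
    levelMap T c (c p) = levelMap T d (d p) := by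
  have h1 : {s ∈ T | c s ≤ c p} = {s ∈ T | d s ≤ d p} :=
    Set.ext fun s => and_congr_right fun hs => h s hs p hp
  have h2 : {s ∈ T | c s < c p} = {s ∈ T | d s < d p} :=
    Set.ext fun s => and_congr_right fun hs => by
      simpa only [not_le] using not_congr (h p hp s hs)
  unfold levelMap
  rw [h1, h2, if_pos ⟨p, hp, rfl⟩, if_pos ⟨p, hp, rfl⟩]

/-- Finite total preorders whose domains pairwise meet in a set on which they all agree
are simultaneously induced by one real-valued map. -/
theorem exists_common_real_key {α ι : Type*} [Finite α] (T : ι → Set α) (T₀ : Set α)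
    (hT : ∀ i j, i ≠ j → T i ∩ T j ⊆ T₀) (c : ι → α → ℕ)
    (hc : ∀ i j, ∀ p ∈ T₀, ∀ q ∈ T₀, (c i p ≤ c i q ↔ c j p ≤ c j q)) :
    ∃ F : α → ℝ, ∀ i, ∀ p ∈ T i, ∀ q ∈ T i, (F p ≤ F q ↔ c i p ≤ c i q) := by
  classical
  let F : α → ℝ := fun p =>
    if h : ∃ i, p ∈ T i then levelMap T₀ (c h.choose) (c h.choose p) else 0
  have hF : ∀ i, ∀ p ∈ T i, F p = levelMap T₀ (c i) (c i p) := by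
    intro i p hp
    have hex : ∃ i, p ∈ T i := ⟨i, hp⟩
    simp only [F, dif_pos hex]
    by_cases hi : hex.choose = i
    · rw [hi]
    · exact levelMap_congr (hc _ _) (hT _ _ hi ⟨hex.choose_spec, hp⟩)
  refine ⟨F, fun i p hp q hq => ?_⟩
  rw [hF i p hp, hF i q hq]
  exact (levelMap_strictMono T₀ (c i)).le_iff_le

namespace StraightEnum

variable {G : GraphOn V} (σ : StraightEnum G)

/-- A position function `pos` refines `σ` if it orders the vertices of distinct blocks
in the same way as `σ`. -/
def RefinedBy (pos : V → ℕ) : Prop :=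
  ∀ u ∈ G.verts, ∀ v ∈ G.verts, pos u ≤ pos v → σ.le u v

variable {σ}

theorem RefinedBy.adj_of_eq {pos : V → ℕ} (h : σ.RefinedBy pos) {u v : V}
    (hu : u ∈ G.verts) (hv : v ∈ G.verts) (huv : u ≠ v) (he : pos u = pos v) : G.Adj u v := by
  have hb := (σ.eq_block u hu v hv).1 ⟨h u hu v hv he.le, h v hv u hu he.ge⟩
  exact ((hb.2.2 v).2 (Or.inr rfl)).resolve_right huv

theorem RefinedBy.adj_of_between {pos : V → ℕ} (h : σ.RefinedBy pos) {u v w : V}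
    (hv : v ∈ G.verts) (huv : pos u ≤ pos v) (hvw : pos v ≤ pos w)
    (ha : G.Adj u w) : (u ≠ v → G.Adj u v) ∧ (v ≠ w → G.Adj v w) := by
  obtain ⟨hu, hw⟩ := G.mem_of_adj ha
  obtain ⟨h1, h2⟩ := σ.straight u hu v hv w hw (h u hu v hv huv) (h v hv w hw hvw) (Or.inl ha)
  exact ⟨fun hne => h1.elim id fun hb => ((hb.2.2 v).2 (Or.inr rfl)).resolve_right hne,
    fun hne => h2.elim id fun hb => ((hb.2.2 w).2 (Or.inr rfl)).resolve_right hne⟩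

/-- The order of all endpoints in a proper interval representation that lists the vertices
by `pos`; `(v, false)` is the left and `(v, true)` the right endpoint of `v`. -/
theorem RefinedBy.exists_endpoint_key [Finite V] {pos : V → ℕ} (h : σ.RefinedBy pos) :
    ∃ c : V × Bool → ℕ, ∀ u ∈ G.verts, ∀ v ∈ G.verts,
      (c (u, false) ≤ c (v, false) ↔ pos u ≤ pos v) ∧
      (c (u, true) ≤ c (v, true) ↔ pos u ≤ pos v) ∧
      (c (v, false) ≤ c (u, true) ↔ (pos v ≤ pos u ∨ G.Adj u v)) ∧
      (c (u, true) ≤ c (v, false) ↔ ¬ (pos v ≤ pos u ∨ G.Adj u v)) := by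
  classical
  have := Fintype.ofFinite V
  let last : V → ℕ := fun u => (Finset.univ.filter fun w => G.Adj u w ∨ u = w).sup pos
  have hlast : ∀ u w, (G.Adj u w ∨ u = w) → pos w ≤ last u := fun u w hw =>
    Finset.le_sup (f := pos) (by simpa using hw)
  have hle : ∀ u ∈ G.verts, ∀ v ∈ G.verts, (pos v ≤ last u ↔ (pos v ≤ pos u ∨ G.Adj u v)) := by
    intro u hu v hv
    refine ⟨fun hvu => ?_, fun hvu => hvu.elim (fun h' => h'.trans (hlast u u (Or.inr rfl)))
      fun h' => hlast u v (Or.inl h')⟩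
    by_contra! hcon
    have hpos : 0 < pos v := (Nat.zero_le _).trans_lt hcon.1
    obtain ⟨w, hw, hvw⟩ := (Finset.le_sup_iff (by simpa using hpos)).1 hvu
    rcases (Finset.mem_filter.1 hw).2 with ha | rfl
    · exact hcon.2 ((h.adj_of_between hv hcon.1.le hvw ha).1
        fun he => by simp [he] at hcon)
    · omega
  have hmono : ∀ u ∈ G.verts, ∀ v ∈ G.verts, pos u ≤ pos v → last u ≤ last v := by
    intro u hu v hv huv
    refine Finset.sup_le fun w hw => ?_
    rcases (Finset.mem_filter.1 hw).2 with ha | rfl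
    · refine (hle v hv w (G.mem_of_adj ha).2).2 ?_
      by_contra! hcon
      exact hcon.2 ((h.adj_of_between hv huv hcon.1.le ha).2 fun he => by simp [he] at hcon)
    · exact huv.trans (hlast v v (Or.inr rfl))
  let key : V × Bool → ℕ ×ₗ ℕ := fun p =>
    if p.2 then toLex (last p.1, pos p.1 + 1) else toLex (pos p.1, 0)
  obtain ⟨c, hc⟩ := exists_nat_key Set.univ (fun p q => key p ≤ key q)
    (fun _ _ _ _ _ _ => le_trans) (fun _ _ _ _ => le_total _ _)
  refine ⟨c, fun u hu v hv => ?_⟩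
  simp only [hc _ (Set.mem_univ _) _ (Set.mem_univ _), key, ← hle u hu v hv]
  have := hmono u hu v hv
  have := hmono v hv u hu
  refine ⟨?_, ?_, ?_, ?_⟩ <;> simp [Prod.Lex.toLex_le_toLex] <;> omega

end StraightEnum

/-- A single interval assignment for all graphs, obtained from position functions that
agree on the shared vertices. -/
theorem exists_properRep_of_refinedBy [Finite V] {k : ℕ} {G : Fin k → GraphOn V} {S : GraphOn V}
    (hsun : IsSunflower G S) {σ : ∀ i, StraightEnum (G i)} (pos : Fin k → V → ℕ)
    (hpos : ∀ i, (σ i).RefinedBy (pos i))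
    (hS : ∀ i j, ∀ u ∈ S.verts, ∀ v ∈ S.verts, (pos i u ≤ pos i v ↔ pos j u ≤ pos j v)) :
    ∃ I : V → ℝ × ℝ, (∀ i, (G i).IsProperRep I) ∧ ∀ i, Realizes (G i) I (σ i) := by
  choose c hc using fun i => (hpos i).exists_endpoint_key
  have hadj : ∀ i j, ∀ u ∈ S.verts, ∀ v ∈ S.verts, ((G i).Adj u v ↔ (G j).Adj u v) :=
    fun i j u hu v hv => ((hsun.1 i).2 u hu v hv).symm.trans ((hsun.1 j).2 u hu v hv)
  obtain ⟨F, hF⟩ := exists_common_real_key (fun i => {p : V × Bool | p.1 ∈ (G i).verts})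
    {p | p.1 ∈ S.verts} (fun i j hij p hp => (hsun.2 i j hij).1.subset hp) c (by
      rintro i j ⟨u, a⟩ hu ⟨v, b⟩ hv
      have hu' : u ∈ S.verts := hu
      have hv' : v ∈ S.verts := hv
      obtain ⟨a1, a2, a3, a4⟩ := hc i u ((hsun.1 i).1 hu) v ((hsun.1 i).1 hv)
      obtain ⟨b1, b2, b3, b4⟩ := hc j u ((hsun.1 j).1 hu) v ((hsun.1 j).1 hv)
      obtain ⟨-, -, a3', -⟩ := hc i v ((hsun.1 i).1 hv) u ((hsun.1 i).1 hu)
      obtain ⟨-, -, b3', -⟩ := hc j v ((hsun.1 j).1 hv) u ((hsun.1 j).1 hu)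
      have e1 := hS i j u hu v hv
      have e2 := hS i j v hv u hu
      have e3 := hadj i j u hu v hv
      have e4 := hadj i j v hv u hu
      cases a <;> cases b
      · rw [a1, b1, e1]
      · rw [a3', b3', e1, e4]
      · rw [a4, b4, e2, e3]
      · rw [a2, b2, e1])
  refine ⟨fun v => (F (v, false), F (v, true)), fun i => ?_, fun i u hu v hv huv => ?_⟩
  · have key : ∀ u ∈ (G i).verts, ∀ v ∈ (G i).verts,
        (F (u, false) ≤ F (v, false) ↔ pos i u ≤ pos i v) ∧
        (F (u, true) ≤ F (v, true) ↔ pos i u ≤ pos i v) ∧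
        (F (v, false) ≤ F (u, true) ↔ (pos i v ≤ pos i u ∨ (G i).Adj u v)) := by
      intro u hu v hv
      obtain ⟨h1, h2, h3, -⟩ := hc i u hu v hv
      exact ⟨(hF i (u, false) hu (v, false) hv).trans h1, (hF i (u, true) hu (v, true) hv).trans h2,
        (hF i (v, false) hv (u, true) hu).trans h3⟩
    have hne : ∀ v ∈ (G i).verts, F (v, false) ≤ F (v, true) := fun v hv =>
      (key v hv v hv).2.2.2 (Or.inl le_rfl)
    refine ⟨⟨hne, fun u hu v hv huv => ?_⟩, fun u hu v hv _ hss => ?_⟩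
    · simp only [ivl, Set.Icc_inter_Icc, Set.nonempty_Icc, sup_le_iff, le_inf_iff]
      have h1 := (key u hu v hv).2.2
      have h2 := (key v hv u hu).2.2
      constructor
      · rintro ⟨⟨-, hvu'⟩, huv', -⟩
        rcases h1.1 hvu' with h3 | h3
        · rcases h2.1 huv' with h4 | h4
          · exact (hpos i).adj_of_eq hu hv huv (le_antisymm h4 h3)
          · exact (G i).symm h4
        · exact h3
      · exact fun ha => ⟨⟨hne u hu, h1.2 (Or.inr ha)⟩,
          h2.2 (Or.inr ((G i).symm ha)), hne v hv⟩
    · obtain ⟨hl, hr⟩ := (Set.Icc_subset_Icc_iff (hne v hv)).1 hss.subset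
      have h1 := (key u hu v hv).1.1 hl
      have h2 := (key v hv u hu).2.1.1 hr
      refine hss.not_subset ((Set.Icc_subset_Icc_iff (hne u hu)).2 ⟨?_, ?_⟩)
      · exact (key v hv u hu).1.2 h2
      · exact (key u hu v hv).2.1.2 h1
  · by_contra! hle
    have h1 := (hc i v hv u hu).1.1 ((hF i (v, false) hv (u, false) hu).1 hle)
    exact huv.2 (hpos i v hv u hu h1)

/-- A simultaneous enumeration admits position functions that agree on the shared vertices. -/
theorem IsSimEnum.exists_refinedBy [Finite V] {k : ℕ} {G : Fin k → GraphOn V} {S : GraphOn V}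
    (hS : ∀ i, S.verts ⊆ (G i).verts) {σ : ∀ i, StraightEnum (G i)} (hσ : IsSimEnum G S σ) :
    ∃ pos : Fin k → V → ℕ, (∀ i, (σ i).RefinedBy (pos i)) ∧
      ∀ i j, ∀ u ∈ S.verts, ∀ v ∈ S.verts, (pos i u ≤ pos i v ↔ pos j u ≤ pos j v) := by
  choose a ha using fun i => exists_nat_key (G i).verts (σ i).le (σ i).trans (σ i).total
  obtain ⟨ρ, hρ⟩ := exists_nat_key S.verts (fun u v => ∀ i, (σ i).le u v)
    (fun u hu v hv w hw h1 h2 i =>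
      (σ i).trans u (hS i hu) v (hS i hv) w (hS i hw) (h1 i) (h2 i))
    (fun u hu v hv => by
      by_contra! hcon
      obtain ⟨⟨i, hi⟩, j, hj⟩ := hcon
      exact hj (hσ i j v hv u hu
        ⟨((σ i).total u (hS i hu) v (hS i hv)).resolve_left hi, hi⟩))
  choose pos hp using fun i => exists_nat_key Set.univ
    (fun u v => toLex (a i u, ρ u) ≤ toLex (a i v, ρ v))
    (fun _ _ _ _ _ _ => le_trans) (fun _ _ _ _ => le_total _ _)
  have hpos : ∀ i u v, pos i u ≤ pos i v ↔ (a i u < a i v ∨ a i u = a i v ∧ ρ u ≤ ρ v) :=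
    fun i u v => (hp i u (Set.mem_univ u) v (Set.mem_univ v)).trans Prod.Lex.toLex_le_toLex
  have hshared : ∀ i, ∀ u ∈ S.verts, ∀ v ∈ S.verts, (pos i u ≤ pos i v ↔ ρ u ≤ ρ v) := by
    intro i u hu v hv
    rw [hpos]
    constructor
    · rintro (h | h)
      · have h1 := (ha i u (hS i hu) v (hS i hv)).1 h.le
        have h2 := fun h' => h.not_ge ((ha i v (hS i hv) u (hS i hu)).2 h')
        exact (hρ u hu v hv).2 fun j => hσ i j u hu v hv ⟨h1, h2⟩
      · exact h.2
    · intro h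
      have h1 := (ha i u (hS i hu) v (hS i hv)).2 ((hρ u hu v hv).1 h i)
      exact h1.lt_or_eq.imp id fun h2 => ⟨h2, h⟩
  refine ⟨pos, fun i u hu v hv h => (ha i u hu v hv).1 ?_, fun i j u hu v hv => ?_⟩
  · rcases (hpos i u v).1 h with h | h
    exacts [h.le, h.1.le]
  · rw [hshared i u hu v hv, hshared j u hu v hv]

namespace GraphOn

theorem SameBlock.trans {G : GraphOn V} {u v w : V} (h : G.SameBlock u v)
    (h' : G.SameBlock v w) : G.SameBlock u w :=
  ⟨h.1, h'.2.1, fun x => (h.2.2 x).trans (h'.2.2 x)⟩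

theorem SameBlock.cAdj_left {G : GraphOn V} {u v w : V} (h : G.SameBlock u v)
    (ha : G.CAdj v w) : G.CAdj u w := by
  rcases ha with ha | ha
  · rcases (h.2.2 w).2 (Or.inl ha) with h' | rfl
    · exact Or.inl h'
    · exact Or.inr ⟨h.1, h.1, fun _ => Iff.rfl⟩
  · exact Or.inr (h.trans ha)

namespace IsProperRep

variable {G : GraphOn V} {I : V → ℝ × ℝ}

theorem snd_le_snd (h : G.IsProperRep I) {u v : V} (hu : u ∈ G.verts) (hv : v ∈ G.verts)
    (huv : (I u).1 ≤ (I v).1) : (I u).2 ≤ (I v).2 := by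
  by_contra! hlt
  refine h.2 u hu v hv (fun he => by simp [he] at hlt) ⟨Set.Icc_subset_Icc huv hlt.le, fun hs => ?_⟩
  exact hlt.not_ge (hs ⟨h.1.1 u hu, le_rfl⟩).2

theorem adj_or_eq_iff (h : G.IsProperRep I) {u v : V} (hu : u ∈ G.verts) (hv : v ∈ G.verts) :
    (G.Adj u v ∨ u = v) ↔ (I u).1 ≤ (I v).2 ∧ (I v).1 ≤ (I u).2 := by
  have h1 := h.1.1 u hu
  have h2 := h.1.1 v hv
  by_cases huv : u = v
  · subst huv
    simp [h1]
  · rw [← h.1.2 u hu v hv huv]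
    simp only [ivl, Set.Icc_inter_Icc, Set.nonempty_Icc, sup_le_iff, le_inf_iff]
    tauto

theorem cAdj_iff_s2 (h : G.IsProperRep I) {u v : V} (hu : u ∈ G.verts) (hv : v ∈ G.verts) :
    G.CAdj u v ↔ (I u).1 ≤ (I v).2 ∧ (I v).1 ≤ (I u).2 := by
  rw [← h.adj_or_eq_iff hu hv]
  constructor
  · rintro (ha | hb)
    exacts [Or.inl ha, (hb.2.2 v).2 (Or.inr rfl)]
  · rintro (ha | rfl)
    exacts [Or.inl ha, Or.inr ⟨hu, hu, fun _ => Iff.rfl⟩]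

/-- Blocks are consecutive in the order by left endpoints. -/
theorem sameBlock_of_between_s2 (h : G.IsProperRep I) {u v w : V} (hw : w ∈ G.verts)
    (hb : G.SameBlock u v) (huw : (I u).1 ≤ (I w).1) (hwv : (I w).1 ≤ (I v).1) :
    G.SameBlock u w := by
  obtain ⟨hu, hv, hN⟩ := hb
  refine ⟨hu, hw, fun x => ?_⟩
  by_cases hx : x ∈ G.verts
  · have huv := (h.adj_or_eq_iff hu hv).1 ((hN v).2 (Or.inr rfl))
    have hNx := hN x
    rw [h.adj_or_eq_iff hu hx, h.adj_or_eq_iff hv hx] at hNx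
    rw [h.adj_or_eq_iff hu hx, h.adj_or_eq_iff hw hx]
    have r1 := h.snd_le_snd hu hw huw
    have r2 := h.snd_le_snd hw hv hwv
    have hx' := h.1.1 x hx
    constructor
    · intro h1
      have h2 := hNx.1 h1
      exact ⟨by linarith, by linarith⟩
    · rintro ⟨h1, h2⟩
      by_cases h3 : (I x).1 ≤ (I u).2
      · exact ⟨by linarith, h3⟩
      · exact hNx.2 ⟨by linarith, by linarith⟩
  · exact ⟨fun h' => (hx (h'.elim (fun ha => (G.mem_of_adj ha).2) fun he => he ▸ hu)).elim,
      fun h' => (hx (h'.elim (fun ha => (G.mem_of_adj ha).2) fun he => he ▸ hw)).elim⟩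

/-- The straight enumeration obtained from a proper interval representation by ordering
the intervals by their left endpoints and grouping blocks. -/
def straightEnum_s2 (h : G.IsProperRep I) : StraightEnum G where
  le u v := G.SameBlock u v ∨ (I u).1 < (I v).1
  refl v hv := Or.inl ⟨hv, hv, fun _ => Iff.rfl⟩
  trans u hu v hv w hw := by
    rintro (huv | huv) (hvw | hvw)
    · exact Or.inl (huv.trans hvw)
    · by_cases hlt : (I u).1 < (I w).1
      · exact Or.inr hlt
      · exact Or.inl (huv.trans (h.sameBlock_of_between_s2 hw huv.symm hvw.le (not_lt.1 hlt)))
    · by_cases hlt : (I u).1 < (I w).1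
      · exact Or.inr hlt
      · exact Or.inl ((h.sameBlock_of_between_s2 hu hvw.symm (not_lt.1 hlt) huv.le).symm)
    · exact Or.inr (huv.trans hvw)
  total u hu v hv := by
    rcases lt_trichotomy (I u).1 (I v).1 with hlt | heq | hlt
    · exact Or.inl (Or.inr hlt)
    · refine Or.inl (Or.inl ⟨hu, hv, fun x => ?_⟩)
      by_cases hx : x ∈ G.verts
      · rw [h.adj_or_eq_iff hu hx, h.adj_or_eq_iff hv hx, heq,
          le_antisymm (h.snd_le_snd hu hv heq.le) (h.snd_le_snd hv hu heq.ge)]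
      · exact ⟨fun h' => (hx (h'.elim (fun ha => (G.mem_of_adj ha).2) fun he => he ▸ hu)).elim,
          fun h' => (hx (h'.elim (fun ha => (G.mem_of_adj ha).2) fun he => he ▸ hv)).elim⟩
    · exact Or.inr (Or.inr hlt)
  eq_block u hu v hv := by
    refine ⟨?_, fun hb => ⟨Or.inl hb, Or.inl hb.symm⟩⟩
    rintro ⟨huv | huv, hvu | hvu⟩
    exacts [huv, huv, hvu.symm, absurd hvu huv.not_gt]
  straight u hu v hv w hw := by
    rintro (huv | huv) (hvw | hvw) ha
    · exact ⟨Or.inr huv, Or.inr hvw⟩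
    · exact ⟨Or.inr huv, huv.symm.cAdj_left ha⟩
    · exact ⟨(hvw.cAdj_left ha.symm).symm, Or.inr hvw⟩
    · have hm := (h.cAdj_iff_s2 hu hw).1 ha
      have r1 := h.snd_le_snd hu hv huv.le
      have r2 := h.snd_le_snd hv hw hvw.le
      have hu' := h.1.1 u hu
      rw [h.cAdj_iff_s2 hu hv, h.cAdj_iff_s2 hv hw]
      exact ⟨⟨by linarith, by linarith⟩, by linarith, by linarith⟩

end IsProperRep

end GraphOn

/-- A sunflower graph admits a simultaneous proper interval
representation iff it has a simultaneous enumeration; moreover any simultaneous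
enumeration is realized by some simultaneous proper interval representation. -/
theorem hasSimProperRep_iff_simEnum {V : Type u} [Fintype V] {k : ℕ}
    (G : Fin k → GraphOn V) (S : GraphOn V) (hsun : IsSunflower G S) :
    (HasSimProperRep G ↔ ∃ σ : ∀ i, StraightEnum (G i), IsSimEnum G S σ) ∧
    (∀ σ : ∀ i, StraightEnum (G i), IsSimEnum G S σ →
      ∃ I : V → ℝ × ℝ, (∀ i, (G i).IsProperRep I) ∧ ∀ i, Realizes (G i) I (σ i)) := by
  have hfwd : ∀ σ : ∀ i, StraightEnum (G i), IsSimEnum G S σ →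
      ∃ I : V → ℝ × ℝ, (∀ i, (G i).IsProperRep I) ∧ ∀ i, Realizes (G i) I (σ i) := by
    intro σ hσ
    obtain ⟨pos, hpos, hS⟩ := hσ.exists_refinedBy fun i => (hsun.1 i).1
    exact exists_properRep_of_refinedBy hsun pos hpos hS
  refine ⟨⟨?_, ?_⟩, hfwd⟩
  · rintro ⟨I, hI⟩
    refine ⟨fun i => (hI i).straightEnum_s2, fun i j u _ v _ huv => ?_⟩
    exact Or.inr (huv.1.resolve_left fun hb => huv.2 (Or.inl hb.symm))
  · rintro ⟨σ, hσ⟩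
    obtain ⟨I, hI, -⟩ := hfwd σ hσ
    exact ⟨I, hI⟩
end
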